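/- arXiv:2410.01467 — 2 statements merged into one kernel-verified Lean document; each statement's English description precedes it below -/
import Mathlib

section
/- For every real α with 0 < α < 1 and every t > 0, the one-parameter Mittag-Leffler function satisfies the integral representation E_α(−t^α) = (sin(απ)/π) · ∫_0^∞ s^{α−1} e^{−s t} / (s^{2α} + 2 s^α cos(απ) + 1) ds, the integral being convergent. -/
open scoped Real
open MeasureTheory

/-- The one-parameter Mittag-Leffler function (real version):
`E_α(x) = ∑_{j=0}^∞ x^j / Γ(jα + 1)`. -/
noncomputable def mittagLeffler (α x : ℝ) : ℝ :=
  ∑' j : ℕ, x ^ j / Real.Gamma ((j : ℝ) * α + 1)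

open Filter Topology

/-- In the logarithmic coordinate `z = exp w`, the integral of `exp (t z) φ dz / (i z)` over the
circle of radius `exp b`, slit along the negative real axis. -/
noncomputable def hankelArc (t : ℝ) (φ : ℂ → ℂ) (b : ℝ) : ℂ :=
  ∫ y in (-π)..π, Complex.exp (t * Complex.exp (b + y * Complex.I)) * φ (b + y * Complex.I)

/-- The difference of the values of `exp (t z) φ` on the two sides of the negative real axis, at
`z = - exp x`. -/
noncomputable def hankelJump (t : ℝ) (φ : ℂ → ℂ) (x : ℝ) : ℂ :=
  Complex.exp (-(t * Real.exp x) : ℝ) * (φ (x + π * Complex.I) - φ (x - π * Complex.I))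

/-- Holomorphy on a neighbourhood of the closed strip `|Im w| ≤ π`. -/
def HolomorphicOnStrip (φ : ℂ → ℂ) : Prop :=
  ∀ w : ℂ, |w.im| ≤ π → DifferentiableAt ℂ φ w

lemma norm_exp_mul_exp_le {t : ℝ} (ht : 0 < t) (b y : ℝ) :
    ‖Complex.exp (t * Complex.exp (b + y * Complex.I))‖ ≤ Real.exp (t * Real.exp b) := by
  rw [Complex.norm_exp]
  apply Real.exp_le_exp.2
  refine (Complex.re_le_norm _).trans ?_
  rw [norm_mul, Complex.norm_exp]
  simp [abs_of_pos ht]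

lemma HolomorphicOnStrip.continuous_vertical {φ : ℂ → ℂ} (hφ : HolomorphicOnStrip φ) (b : ℝ) :
    ContinuousOn (fun y : ℝ => φ (b + y * Complex.I)) (Set.uIcc (-π) π) := by
  intro y hy
  rw [Set.uIcc_of_le (by linarith [Real.pi_pos])] at hy
  have h : ContinuousAt φ (b + y * Complex.I) :=
    (hφ _ (by simpa using abs_le.2 hy)).continuousAt
  exact (ContinuousAt.comp (f := fun y : ℝ => (b + y * Complex.I : ℂ)) h
    (by fun_prop)).continuousWithinAt

lemma HolomorphicOnStrip.intervalIntegrable {φ : ℂ → ℂ} (hφ : HolomorphicOnStrip φ) (t b : ℝ) :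
    IntervalIntegrable (fun y : ℝ =>
      Complex.exp (t * Complex.exp (b + y * Complex.I)) * φ (b + y * Complex.I))
      volume (-π) π :=
  (ContinuousOn.mul (by fun_prop) (hφ.continuous_vertical b)).intervalIntegrable

lemma HolomorphicOnStrip.continuous_top {φ : ℂ → ℂ} (hφ : HolomorphicOnStrip φ) :
    Continuous fun x : ℝ => φ (x + π * Complex.I) :=
  continuous_iff_continuousAt.2 fun x =>
    ContinuousAt.comp (f := fun x : ℝ => (x + π * Complex.I : ℂ))
      (hφ _ (by simp [abs_of_pos Real.pi_pos])).continuousAt (by fun_prop)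

lemma HolomorphicOnStrip.continuous_bottom {φ : ℂ → ℂ} (hφ : HolomorphicOnStrip φ) :
    Continuous fun x : ℝ => φ (x - π * Complex.I) :=
  continuous_iff_continuousAt.2 fun x =>
    ContinuousAt.comp (f := fun x : ℝ => (x - π * Complex.I : ℂ))
      (hφ _ (by simp [abs_of_pos Real.pi_pos])).continuousAt (by fun_prop)

lemma exp_add_pi_mul_I' (x : ℝ) :
    Complex.exp (x + π * Complex.I) = -(Real.exp x : ℂ) := by
  rw [Complex.exp_add, Complex.exp_pi_mul_I]; push_cast; ring

lemma exp_sub_pi_mul_I' (x : ℝ) :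
    Complex.exp (x - π * Complex.I) = -(Real.exp x : ℂ) := by
  rw [Complex.exp_sub, Complex.exp_pi_mul_I]; push_cast; ring

lemma exp_neg_mul_add_pi_mul_I (s x : ℝ) :
    Complex.exp (-(s * (x + π * Complex.I))) =
      Real.exp (-s * x) * (Real.cos (s * π) - Real.sin (s * π) * Complex.I) := by
  have h : -(s * (x + π * Complex.I)) =
      ((-s * x : ℝ) : ℂ) + ((-(s * π) : ℝ) : ℂ) * Complex.I := by
    push_cast; ring
  rw [h, Complex.exp_add, Complex.exp_mul_I, ← Complex.ofReal_exp, ← Complex.ofReal_cos,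
    ← Complex.ofReal_sin, Real.cos_neg, Real.sin_neg]
  push_cast; ring

lemma exp_neg_mul_sub_pi_mul_I (s x : ℝ) :
    Complex.exp (-(s * (x - π * Complex.I))) =
      Real.exp (-s * x) * (Real.cos (s * π) + Real.sin (s * π) * Complex.I) := by
  have h : -(s * (x - π * Complex.I)) =
      ((-s * x : ℝ) : ℂ) + ((s * π : ℝ) : ℂ) * Complex.I := by
    push_cast; ring
  rw [h, Complex.exp_add, Complex.exp_mul_I, ← Complex.ofReal_exp, ← Complex.ofReal_cos,
    ← Complex.ofReal_sin]

lemma hankelArc_sub {φ : ℂ → ℂ} (hφ : HolomorphicOnStrip φ) (t a b : ℝ) :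
    hankelArc t φ b - hankelArc t φ a = -Complex.I * ∫ x in a..b, hankelJump t φ x := by
  have h := Complex.integral_boundary_rect_eq_zero_of_differentiableOn
    (fun w => Complex.exp (t * Complex.exp w) * φ w) (a + (-π : ℝ) * Complex.I)
    (b + (π : ℝ) * Complex.I) (by
      intro w hw
      rw [Complex.mem_reProdIm] at hw
      have h2 := hw.2
      simp only [Complex.add_im, Complex.ofReal_im, Complex.mul_im, Complex.ofReal_re,
        Complex.I_im, Complex.I_re, mul_one, mul_zero, add_zero, zero_add] at h2
      rw [Set.uIcc_of_le (by linarith [Real.pi_pos])] at h2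
      have := hφ w (abs_le.2 h2)
      exact DifferentiableAt.differentiableWithinAt (by fun_prop))
  simp only [Complex.add_im, Complex.ofReal_im, Complex.mul_im, Complex.ofReal_re,
        Complex.I_im, Complex.I_re, mul_one, mul_zero, add_zero, zero_add, Complex.add_re,
        Complex.mul_re, sub_zero, smul_eq_mul] at h
  have hs : ∀ x : ℝ, (x : ℂ) + ((-π : ℝ) : ℂ) * Complex.I = x - π * Complex.I := by
    intro x; push_cast; ring
  simp only [hs, exp_add_pi_mul_I', exp_sub_pi_mul_I'] at h
  change _ + Complex.I * hankelArc t φ b - Complex.I * hankelArc t φ a = 0 at h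
  have hexp : Continuous fun x : ℝ => Complex.exp (t * -(Real.exp x : ℂ)) := by fun_prop
  have e : ∫ x in a..b, hankelJump t φ x =
      (∫ x in a..b, Complex.exp (t * -(Real.exp x : ℂ)) * φ (x + π * Complex.I)) -
      ∫ x in a..b, Complex.exp (t * -(Real.exp x : ℂ)) * φ (x - π * Complex.I) := by
    have htop : Continuous fun x : ℝ =>
        Complex.exp (t * -(Real.exp x : ℂ)) * φ (x + π * Complex.I) := hexp.mul hφ.continuous_top
    have hbottom : Continuous fun x : ℝ =>
        Complex.exp (t * -(Real.exp x : ℂ)) * φ (x - π * Complex.I) :=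
      hexp.mul hφ.continuous_bottom
    rw [← intervalIntegral.integral_sub (htop.intervalIntegrable _ _)
      (hbottom.intervalIntegrable _ _)]
    refine intervalIntegral.integral_congr fun x _ => ?_
    simp only [hankelJump]
    push_cast
    ring_nf
  rw [e]
  linear_combination (-Complex.I) * h + (hankelArc t φ b - hankelArc t φ a) * Complex.I_sq

lemma tendsto_hankelArc_atTop {φ : ℂ → ℂ} (hφ : HolomorphicOnStrip φ) {t : ℝ} (ht : 0 < t)
    (c : ℂ) {C : ℝ} (hC : ∀ᶠ a : ℝ in atBot, ∀ y : ℝ, |y| ≤ π → ‖φ (a + y * Complex.I)‖ ≤ C)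
    (hlim : ∀ y : ℝ, |y| ≤ π → Tendsto (fun a : ℝ => φ (a + y * Complex.I)) atBot (𝓝 c))
    (hint : Integrable (hankelJump t φ)) :
    Tendsto (hankelArc t φ) atTop (𝓝 (2 * π * c - Complex.I * ∫ x, hankelJump t φ x)) := by
  have hbot : Tendsto (hankelArc t φ) atBot (𝓝 (∫ _ in (-π)..π, c)) := by
    refine intervalIntegral.tendsto_integral_filter_of_dominated_convergence
      (fun _ => Real.exp t * C) ?_ ?_ (by simp) ?_
    · refine Eventually.of_forall fun a => ?_
      have := (hφ.intervalIntegrable t a).def'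
      exact this.aestronglyMeasurable
    · filter_upwards [hC, eventually_le_atBot 0] with a ha ha0
      refine Eventually.of_forall fun y hy => ?_
      rw [Set.uIoc_of_le (by linarith [Real.pi_pos])] at hy
      rw [norm_mul]
      refine mul_le_mul ((norm_exp_mul_exp_le ht a y).trans ?_) (ha y (abs_le.2 ⟨hy.1.le, hy.2⟩))
        (norm_nonneg _) (Real.exp_pos _).le
      apply Real.exp_le_exp.2
      nlinarith [Real.exp_le_one_iff.2 ha0]
    · refine Eventually.of_forall fun y hy => ?_
      rw [Set.uIoc_of_le (by linarith [Real.pi_pos])] at hy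
      have h0 : Tendsto (fun a : ℝ => Complex.exp (a + y * Complex.I)) atBot (𝓝 0) := by
        rw [tendsto_zero_iff_norm_tendsto_zero]
        simpa [Complex.norm_exp] using Real.tendsto_exp_atBot
      have h1 : Tendsto (fun a : ℝ => Complex.exp (t * Complex.exp (a + y * Complex.I))) atBot
          (𝓝 1) := by
        have := (Complex.continuous_exp.tendsto _).comp (h0.const_mul (t : ℂ))
        simpa [Function.comp_def] using this
      simpa using h1.mul (hlim y (abs_le.2 ⟨hy.1.le, hy.2⟩))
  have h1 := (hbot.comp tendsto_neg_atTop_atBot).sub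
    ((intervalIntegral_tendsto_integral hint tendsto_neg_atTop_atBot tendsto_id).const_mul
      Complex.I)
  rw [intervalIntegral.integral_const, Complex.real_smul,
    show ((π - -π : ℝ) : ℂ) * c = 2 * π * c by push_cast; ring] at h1
  refine h1.congr fun b => ?_
  have := hankelArc_sub hφ t (-b) b
  simp only [Function.comp, id]
  linear_combination -this

lemma norm_le_of_tendsto_hankelArc {φ : ℂ → ℂ} (hφ : HolomorphicOnStrip φ) {t : ℝ} (ht : 0 < t)
    {B : ℝ} (hB : ∀ w : ℂ, 1 ≤ w.re → |w.im| ≤ π → ‖φ w‖ ≤ B) {K : ℂ}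
    (hK : Tendsto (hankelArc t φ) atTop (𝓝 K)) :
    ‖K‖ ≤ (2 * π * Real.exp (t * Real.exp 1) + 2 / t) * B := by
  have hpi := Real.pi_pos
  have hB0 : 0 ≤ B := (norm_nonneg _).trans (hB 1 (by simp) (by simp [hpi.le]))
  refine le_of_tendsto hK.norm ?_
  filter_upwards [eventually_ge_atTop 1] with b hb
  have h1 : ‖hankelArc t φ 1‖ ≤ Real.exp (t * Real.exp 1) * B * |π - -π| := by
    refine intervalIntegral.norm_integral_le_of_norm_le_const fun y hy => ?_
    rw [Set.uIoc_of_le (by linarith)] at hy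
    rw [norm_mul]
    exact mul_le_mul (norm_exp_mul_exp_le ht 1 y)
      (hB _ (by simp) (by simpa using abs_le.2 ⟨hy.1.le, hy.2⟩)) (norm_nonneg _)
      (Real.exp_pos _).le
  have h2 : ‖∫ x in (1 : ℝ)..b, hankelJump t φ x‖ ≤
      ∫ x in (1 : ℝ)..b, 2 * B * Real.exp (-t * x) := by
    refine intervalIntegral.norm_integral_le_of_norm_le hb (Eventually.of_forall fun x hx => ?_)
      (Continuous.intervalIntegrable (by fun_prop) _ _)
    unfold hankelJump
    rw [norm_mul, Complex.norm_exp, mul_comm, Complex.ofReal_re]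
    refine mul_le_mul ?_ ?_ (Real.exp_pos _).le (by positivity)
    · refine (norm_sub_le _ _).trans ?_
      have := hB (x + π * Complex.I) (by simpa using hx.1.le) (by simp [abs_of_pos hpi])
      have := hB (x - π * Complex.I) (by simpa using hx.1.le) (by simp [abs_of_pos hpi])
      linarith
    · apply Real.exp_le_exp.2
      nlinarith [Real.add_one_le_exp x]
  have h3 : ∫ x in (1 : ℝ)..b, 2 * B * Real.exp (-t * x) ≤ 2 / t * B := by
    have hd : ∀ x ∈ Set.uIcc 1 b, HasDerivAt (fun x => -(2 * B / t) * Real.exp (-t * x))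
        (2 * B * Real.exp (-t * x)) x := by
      intro x _
      have := (((hasDerivAt_id x).const_mul (-t)).exp).const_mul (-(2 * B / t))
      refine this.congr_deriv ?_
      simp only [id_eq]
      field_simp
    rw [intervalIntegral.integral_eq_sub_of_hasDerivAt hd
      (Continuous.intervalIntegrable (by fun_prop) _ _)]
    have e1 : Real.exp (-t * 1) ≤ 1 := Real.exp_le_one_iff.2 (by linarith)
    have e2 := Real.exp_pos (-t * b)
    have : 0 ≤ 2 * B / t := by positivity
    have : 2 / t * B = 2 * B / t := by ring
    nlinarith
  have h4 := hankelArc_sub hφ t 1 b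
  have h5 : hankelArc t φ b = hankelArc t φ 1 + -Complex.I * ∫ x in (1:ℝ)..b, hankelJump t φ x := by
    linear_combination h4
  rw [h5]
  refine (norm_add_le _ _).trans ?_
  rw [norm_mul, norm_neg, Complex.norm_I, one_mul]
  rw [abs_of_pos (by linarith)] at h1
  linarith

lemma integrable_exp_mul_comp_exp_iff {F : ℝ → ℝ} :
    Integrable (fun x => Real.exp x * F (Real.exp x)) ↔ IntegrableOn F (Set.Ioi 0) := by
  have h := integrableOn_image_iff_integrableOn_abs_deriv_smul (s := Set.univ) MeasurableSet.univ
    (fun x _ => (Real.hasDerivAt_exp x).hasDerivWithinAt) Real.exp_injective.injOn F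
  rw [Set.image_univ, Real.range_exp, integrableOn_univ] at h
  simpa using h.symm

lemma integral_exp_mul_comp_exp (F : ℝ → ℝ) :
    ∫ x, Real.exp x * F (Real.exp x) = ∫ s in Set.Ioi 0, F s := by
  have h := integral_image_eq_integral_abs_deriv_smul (s := Set.univ) MeasurableSet.univ
    (fun x _ => (Real.hasDerivAt_exp x).hasDerivWithinAt) Real.exp_injective.injOn F
  rw [Set.image_univ, Real.range_exp, setIntegral_univ] at h
  simpa using h.symm

/-- If the jump is `2 i k` times the pullback of a function `F` integrable on `(0, ∞)`, and `φ`
vanishes at `-∞`, then the arc integrals converge to `2 k ∫ F`. -/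
lemma tendsto_hankelArc_of_jump_eq {φ : ℂ → ℂ} (hφ : HolomorphicOnStrip φ) {t : ℝ} (ht : 0 < t)
    {β : ℝ → ℝ} (hβ : Tendsto β atBot (𝓝 0))
    (hb : ∀ᶠ a : ℝ in atBot, ∀ y : ℝ, ‖φ (a + y * Complex.I)‖ ≤ β a) {k : ℝ} {F : ℝ → ℝ}
    (hF : IntegrableOn F (Set.Ioi 0))
    (hj : ∀ x, hankelJump t φ x = 2 * Complex.I * k * ((Real.exp x * F (Real.exp x) : ℝ) : ℂ)) :
    Tendsto (hankelArc t φ) atTop (𝓝 ((2 * k * ∫ s in Set.Ioi 0, F s : ℝ) : ℂ)) := by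
  have hj' : hankelJump t φ = fun x =>
    2 * Complex.I * k * ((Real.exp x * F (Real.exp x) : ℝ) : ℂ) := funext hj
  have h := tendsto_hankelArc_atTop hφ ht 0 (C := 1) ?_ ?_ ?_
  · convert h using 2
    rw [hj', integral_const_mul, integral_complex_ofReal, integral_exp_mul_comp_exp]
    push_cast
    linear_combination (2 * (k : ℂ) * ((∫ s in Set.Ioi 0, F s : ℝ) : ℂ)) * Complex.I_sq
  · filter_upwards [hb, hβ.eventually_le_const one_pos] with a ha h1 y _
    exact (ha y).trans h1
  · intro y _
    refine squeeze_zero_norm' ?_ hβ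
    filter_upwards [hb] with a ha using ha y
  · rw [hj']
    exact ((integrable_exp_mul_comp_exp_iff.2 hF).ofReal).const_mul _

lemma holomorphicOnStrip_exp (s : ℝ) : HolomorphicOnStrip fun w => Complex.exp (-(s * w)) :=
  fun w _ => by fun_prop

lemma tendsto_hankelArc_exp_of_neg {s t : ℝ} (hs : s < 0) (ht : 0 < t) :
    Tendsto (hankelArc t fun w => Complex.exp (-(s * w))) atTop
      (𝓝 ((2 * π * (t ^ s / Real.Gamma (s + 1)) : ℝ) : ℂ)) := by
  have hF := integrableOn_rpow_mul_exp_neg_mul_rpow (p := 1) (s := -s - 1) (b := t)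
    (by linarith) one_pos ht
  simp only [Real.rpow_one, neg_mul] at hF
  have h := tendsto_hankelArc_of_jump_eq (holomorphicOnStrip_exp s) ht
    (β := fun a => Real.exp (-s * a)) (k := Real.sin (π * -s)) ?_ ?_ hF ?_
  · convert h using 3
    rw [Real.integral_rpow_mul_exp_neg_mul_Ioi (by linarith) ht]
    have hΓ := Real.Gamma_mul_Gamma_one_sub (-s)
    rw [show 1 - -s = s + 1 by ring] at hΓ
    have hpos : Real.Gamma (-s) ≠ 0 := (Real.Gamma_pos_of_pos (by linarith)).ne'
    have hp : (1 / t) ^ (-s) = t ^ s := by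
      rw [one_div, Real.inv_rpow ht.le, Real.rpow_neg ht.le, inv_inv]
    rw [hp]
    generalize Real.sin (π * -s) = S at hΓ ⊢
    by_cases h0 : S = 0
    · rw [h0, div_zero] at hΓ
      have := (mul_eq_zero.1 hΓ).resolve_left hpos
      rw [h0, this]; simp
    · have h1 : Real.Gamma (s + 1) ≠ 0 := by
        intro h1
        rw [h1, mul_zero] at hΓ
        exact (div_ne_zero Real.pi_ne_zero h0) hΓ.symm
      rw [eq_div_iff h0] at hΓ
      field_simp
      linear_combination -hΓ
  · exact Real.tendsto_exp_atBot.comp (tendsto_id.const_mul_atBot (by linarith))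
  · refine Eventually.of_forall fun a y => ?_
    rw [Complex.norm_exp]
    simp
  · intro x
    have e3 : Real.exp x * (Real.exp x ^ (-s - 1) * Real.exp (-(t * Real.exp x))) =
        Real.exp (-s * x) * Real.exp (-(t * Real.exp x)) := by
      rw [← Real.exp_mul, ← mul_assoc, ← Real.exp_add]; ring_nf
    rw [hankelJump, exp_neg_mul_add_pi_mul_I, exp_neg_mul_sub_pi_mul_I, e3,
      show π * -s = -(s * π) by ring, Real.sin_neg]
    push_cast
    ring

lemma tendsto_hankelArc_one {t : ℝ} (ht : 0 < t) :
    Tendsto (hankelArc t fun _ => 1) atTop (𝓝 (2 * π)) := by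
  have hj : hankelJump t (fun _ => 1) = fun _ => 0 := by ext x; simp [hankelJump]
  have h := tendsto_hankelArc_atTop (φ := fun _ => 1) (fun w _ => by fun_prop) ht 1 (C := 1)
    (by simp) (fun y _ => tendsto_const_nhds) (by rw [hj]; exact integrable_zero _ _ _)
  simpa [hj] using h

lemma hankelArc_exp_recurrence (s t b : ℝ) :
    t * hankelArc t (fun w => Complex.exp (-((s - 1 : ℝ) * w))) b -
      s * hankelArc t (fun w => Complex.exp (-(s * w))) b =
    -Complex.I * hankelJump t (fun w => Complex.exp (-(s * w))) b := by
  have hd : ∀ y ∈ Set.uIcc (-π) π, HasDerivAt (fun y : ℝ =>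
      Complex.exp (t * Complex.exp (b + y * Complex.I)) *
        Complex.exp (-(s * (b + y * Complex.I))))
      (Complex.I * (t * (Complex.exp (t * Complex.exp (b + y * Complex.I)) *
        Complex.exp (-((s - 1 : ℝ) * (b + y * Complex.I)))) -
        s * (Complex.exp (t * Complex.exp (b + y * Complex.I)) *
        Complex.exp (-(s * (b + y * Complex.I)))))) y := by
    intro y _
    have hw : HasDerivAt (fun y : ℝ => (b + y * Complex.I : ℂ)) Complex.I y := by
      simpa using ((hasDerivAt_id y).ofReal_comp.mul_const Complex.I).const_add (b : ℂ)
    have h := ((hw.cexp.const_mul (t : ℂ)).cexp).mul ((hw.const_mul (s : ℂ)).neg.cexp)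
    refine h.congr_deriv ?_
    have : Complex.exp (-((s - 1 : ℝ) * (b + y * Complex.I))) =
        Complex.exp (b + y * Complex.I) * Complex.exp (-(s * (b + y * Complex.I))) := by
      rw [← Complex.exp_add]; push_cast; ring_nf
    rw [this, Pi.neg_apply]
    ring
  have h := intervalIntegral.integral_eq_sub_of_hasDerivAt hd
    (Continuous.intervalIntegrable (by fun_prop) _ _)
  rw [intervalIntegral.integral_const_mul, intervalIntegral.integral_sub
    (Continuous.intervalIntegrable (by fun_prop) _ _)
    (Continuous.intervalIntegrable (by fun_prop) _ _), intervalIntegral.integral_const_mul,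
    intervalIntegral.integral_const_mul] at h
  have hs : (b : ℂ) + ((-π : ℝ) : ℂ) * Complex.I = b - π * Complex.I := by
    push_cast; ring
  rw [hs, exp_add_pi_mul_I', exp_sub_pi_mul_I'] at h
  change Complex.I * (t * hankelArc t (fun w => Complex.exp (-((s - 1 : ℝ) * w))) b -
    s * hankelArc t (fun w => Complex.exp (-(s * w))) b) = _ at h
  have hj : hankelJump t (fun w => Complex.exp (-(s * w))) b =
      Complex.exp (t * -(Real.exp b : ℂ)) * Complex.exp (-(s * (b + π * Complex.I))) -
      Complex.exp (t * -(Real.exp b : ℂ)) * Complex.exp (-(s * (b - π * Complex.I))) := by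
    rw [hankelJump]; push_cast; ring_nf
  rw [hj, ← h, ← mul_assoc]
  simp

lemma tendsto_hankelJump_exp {s t : ℝ} (hs : 0 < s) (ht : 0 < t) :
    Tendsto (hankelJump t fun w => Complex.exp (-(s * w))) atTop (𝓝 0) := by
  have h0 : Tendsto (fun b => 2 * Real.exp (-s * b)) atTop (𝓝 0) := by
    simpa using (Real.tendsto_exp_atBot.comp
      (tendsto_id.const_mul_atTop_of_neg (neg_lt_zero.2 hs))).const_mul 2
  refine squeeze_zero_norm (fun b => ?_) h0
  rw [hankelJump, norm_mul, Complex.norm_exp, Complex.ofReal_re]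
  have h1 : Real.exp (-(t * Real.exp b)) ≤ 1 :=
    Real.exp_le_one_iff.2 (neg_nonpos.2 (by positivity))
  have h2 : ‖Complex.exp (-(s * (b + π * Complex.I))) -
      Complex.exp (-(s * (b - π * Complex.I)))‖ ≤ 2 * Real.exp (-s * b) := by
    refine (norm_sub_le _ _).trans (le_of_eq ?_)
    simp [Complex.norm_exp, two_mul]
  calc _ ≤ 1 * (2 * Real.exp (-s * b)) := mul_le_mul h1 h2 (norm_nonneg _) zero_le_one
    _ = _ := one_mul _

/-- Hankel's formula for the reciprocal of the Gamma function. -/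
lemma tendsto_hankelArc_exp (s : ℝ) {t : ℝ} (ht : 0 < t) :
    Tendsto (hankelArc t fun w => Complex.exp (-(s * w))) atTop
      (𝓝 ((2 * π * (t ^ s / Real.Gamma (s + 1)) : ℝ) : ℂ)) := by
  obtain ⟨n, hn⟩ := exists_nat_gt s
  induction n generalizing s with
  | zero => exact tendsto_hankelArc_exp_of_neg (by simpa using hn) ht
  | succ n ih =>
    rcases lt_trichotomy s 0 with h | rfl | h
    · exact tendsto_hankelArc_exp_of_neg h ht
    · simpa using tendsto_hankelArc_one ht
    · have h1 := ih (s - 1) (by push_cast at hn; linarith)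
      have h2 := ((h1.const_mul (t : ℂ)).sub
        ((tendsto_hankelJump_exp h ht).const_mul (-Complex.I))).const_mul (s : ℂ)⁻¹
      have hs : (s : ℂ) ≠ 0 := by exact_mod_cast h.ne'
      convert h2 using 2
      · rename_i b
        rw [← hankelArc_exp_recurrence s t b]
        field_simp
        ring
      · rw [mul_zero, sub_zero, sub_add_cancel]
        norm_cast
        have hΓ : Real.Gamma s ≠ 0 := (Real.Gamma_pos_of_pos h).ne'
        rw [Real.Gamma_add_one h.ne', Real.rpow_sub_one ht.ne']
        field_simp

lemma one_add_exp_ne_zero {α : ℝ} (hα0 : 0 < α) (hα1 : α < 1) {w : ℂ} (hw : |w.im| ≤ π) :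
    1 + Complex.exp (-(α * w)) ≠ 0 := by
  intro h
  have him := congrArg Complex.im h
  have hre := congrArg Complex.re h
  simp only [Complex.add_im, Complex.one_im, Complex.exp_im, Complex.add_re, Complex.one_re,
    Complex.exp_re, Complex.neg_im, Complex.neg_re, Complex.re_ofReal_mul, Complex.im_ofReal_mul,
    Complex.zero_im, Complex.zero_re, zero_add, mul_eq_zero, Real.exp_ne_zero, false_or] at him hre
  have hpi := Real.pi_pos
  obtain ⟨h1, h2⟩ := abs_le.1 hw
  have h0 : -(α * w.im) = 0 :=
    (Real.sin_eq_zero_iff_of_lt_of_lt (by nlinarith) (by nlinarith)).1 him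
  rw [h0, Real.cos_zero] at hre
  linarith [Real.exp_pos (-(α * w.re))]

/-- The remainder of the geometric series of `1 / (1 + exp (-α w))` after `n` terms. -/
noncomputable def geomRemainder (α : ℝ) (n : ℕ) (w : ℂ) : ℂ :=
  (-Complex.exp (-(α * w))) ^ n * (1 + Complex.exp (-(α * w)))⁻¹

lemma holomorphicOnStrip_geomRemainder {α : ℝ} (hα0 : 0 < α) (hα1 : α < 1) (n : ℕ) :
    HolomorphicOnStrip (geomRemainder α n) := by
  intro w hw
  have := one_add_exp_ne_zero hα0 hα1 hw
  unfold geomRemainder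
  fun_prop (disch := assumption)

lemma geomRemainder_succ {α : ℝ} (hα0 : 0 < α) (hα1 : α < 1) (n : ℕ) {w : ℂ}
    (hw : |w.im| ≤ π) :
    geomRemainder α (n + 1) w =
      geomRemainder α n w - (-1) ^ n * Complex.exp (-((n * α : ℝ) * w)) := by
  have h := one_add_exp_ne_zero hα0 hα1 hw
  have e : Complex.exp (-((n * α : ℝ) * w)) = Complex.exp (-(α * w)) ^ n := by
    rw [← Complex.exp_nat_mul]; push_cast; ring_nf
  rw [e, geomRemainder, geomRemainder, ← mul_pow, neg_one_mul]
  field_simp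
  ring

lemma hankelArc_geomRemainder_succ {α : ℝ} (hα0 : 0 < α) (hα1 : α < 1) (n : ℕ) (t b : ℝ) :
    hankelArc t (geomRemainder α (n + 1)) b = hankelArc t (geomRemainder α n) b -
      (-1) ^ n * hankelArc t (fun w => Complex.exp (-((n * α : ℝ) * w))) b := by
  unfold hankelArc
  rw [← intervalIntegral.integral_const_mul, ← intervalIntegral.integral_sub
    ((holomorphicOnStrip_geomRemainder hα0 hα1 n).intervalIntegrable t b)
    (((holomorphicOnStrip_exp (n * α)).intervalIntegrable t b).const_mul _)]
  refine intervalIntegral.integral_congr fun y hy => ?_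
  rw [Set.uIcc_of_le (by linarith [Real.pi_pos])] at hy
  rw [geomRemainder_succ hα0 hα1 n (by simpa using abs_le.2 hy)]
  ring

lemma norm_exp_le {α : ℝ} (hα0 : 0 < α) {w : ℂ} (hw : 1 ≤ w.re) :
    ‖Complex.exp (-(α * w))‖ ≤ Real.exp (-α) := by
  rw [Complex.norm_exp]
  apply Real.exp_le_exp.2
  simp only [Complex.neg_re, Complex.re_ofReal_mul]
  nlinarith

lemma norm_geomRemainder_le {α : ℝ} (hα0 : 0 < α) (n : ℕ) {w : ℂ} (hw : 1 ≤ w.re) :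
    ‖geomRemainder α n w‖ ≤ Real.exp (-α) ^ n * (1 - Real.exp (-α))⁻¹ := by
  have h := norm_exp_le hα0 hw
  have h1 : Real.exp (-α) < 1 := Real.exp_lt_one_iff.2 (by linarith)
  rw [geomRemainder, norm_mul, norm_pow, norm_neg, norm_inv]
  have hinv : ‖1 + Complex.exp (-(α * w))‖⁻¹ ≤ (1 - Real.exp (-α))⁻¹ := by
    refine inv_anti₀ (by linarith) ?_
    have := norm_sub_le_norm_add (1 : ℂ) (Complex.exp (-(α * w)))
    rw [norm_one] at this
    linarith
  gcongr

/-- The spectral density in the integral representation of the Mittag-Leffler function. -/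
noncomputable def mittagLefflerIntegrand (α t s : ℝ) : ℝ :=
  s ^ (α - 1) * Real.exp (-(s * t)) / (s ^ (2 * α) + 2 * s ^ α * Real.cos (α * π) + 1)

lemma integrableOn_mittagLefflerIntegrand {α t : ℝ} (hα0 : 0 < α) (hα1 : α < 1) (ht : 0 < t) :
    IntegrableOn (mittagLefflerIntegrand α t) (Set.Ioi 0) := by
  have hF := integrableOn_rpow_mul_exp_neg_mul_rpow (p := 1) (s := α - 1) (b := t)
    (by linarith) one_pos ht
  simp only [Real.rpow_one, neg_mul] at hF
  have hsin : 0 < Real.sin (α * π) ^ 2 := by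
    have := Real.sin_pos_of_pos_of_lt_pi (x := α * π) (by positivity)
      (by nlinarith [Real.pi_pos])
    positivity
  refine (hF.mul_const (Real.sin (α * π) ^ 2)⁻¹).mono' ?_ ?_
  · exact Measurable.aestronglyMeasurable (by unfold mittagLefflerIntegrand; fun_prop)
  · filter_upwards [ae_restrict_mem measurableSet_Ioi] with s hs
    rw [Set.mem_Ioi] at hs
    have hden : Real.sin (α * π) ^ 2 ≤
        s ^ (2 * α) + 2 * s ^ α * Real.cos (α * π) + 1 := by
      have : s ^ (2 * α) = (s ^ α) ^ 2 := by
        rw [← Real.rpow_natCast, ← Real.rpow_mul hs.le]; ring_nf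
      rw [this]
      nlinarith [sq_nonneg (s ^ α + Real.cos (α * π)), Real.sin_sq_add_cos_sq (α * π)]
    have hpos := hsin.trans_le hden
    rw [mittagLefflerIntegrand, Real.norm_of_nonneg (by positivity), div_eq_mul_inv,
      mul_comm s t]
    gcongr

lemma hankelJump_geomRemainder_zero {α : ℝ} (hα0 : 0 < α) (hα1 : α < 1) (t x : ℝ) :
    hankelJump t (geomRemainder α 0) x = 2 * Complex.I * Real.sin (α * π) *
      ((Real.exp x * mittagLefflerIntegrand α t (Real.exp x) : ℝ) : ℂ) := by
  have hsin : 0 < Real.sin (α * π) :=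
    Real.sin_pos_of_pos_of_lt_pi (by positivity) (by nlinarith [Real.pi_pos])
  have hsc := Real.sin_sq_add_cos_sq (α * π)
  have hinv : Real.exp (-α * x) = (Real.exp (α * x))⁻¹ := by rw [neg_mul, Real.exp_neg]
  have h1 := one_add_exp_ne_zero hα0 hα1 (w := x + π * Complex.I)
    (by simp [abs_of_pos Real.pi_pos])
  have h2 := one_add_exp_ne_zero hα0 hα1 (w := x - π * Complex.I)
    (by simp [abs_of_pos Real.pi_pos])
  have e3 : Real.exp x * mittagLefflerIntegrand α t (Real.exp x) =
      Real.exp (-(t * Real.exp x)) * (Real.exp (α * x) /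
        (Real.exp (α * x) ^ 2 + 2 * Real.exp (α * x) * Real.cos (α * π) + 1)) := by
    have hu : Real.exp x ^ α = Real.exp (α * x) := by rw [← Real.exp_mul, mul_comm]
    have hu1 : Real.exp x * Real.exp x ^ (α - 1) = Real.exp (α * x) := by
      rw [← Real.exp_mul, ← Real.exp_add]; ring_nf
    have hu2 : Real.exp x ^ (2 * α) = Real.exp (α * x) ^ 2 := by
      rw [← Real.exp_mul, ← Real.exp_nat_mul]; ring_nf
    rw [mittagLefflerIntegrand, hu, hu2, ← hu1, mul_comm t]
    ring
  rw [e3, hankelJump, geomRemainder, geomRemainder, pow_zero, pow_zero, one_mul, one_mul]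
  rw [exp_neg_mul_add_pi_mul_I, hinv, Complex.ofReal_inv] at h1 ⊢
  rw [exp_neg_mul_sub_pi_mul_I, hinv, Complex.ofReal_inv] at h2 ⊢
  have hu := Real.exp_pos (α * x)
  generalize Real.exp (α * x) = u at *
  generalize Real.cos (α * π) = c at *
  generalize Real.sin (α * π) = s at *
  have hd : u ^ 2 + 2 * u * c + 1 ≠ 0 := by nlinarith [sq_nonneg (u + c), pow_pos hsin 2]
  have hd' : (u : ℂ) ^ 2 + 2 * u * c + 1 ≠ 0 := by exact_mod_cast hd
  have hu' : (u : ℂ) ≠ 0 := by exact_mod_cast hu.ne'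
  have hsc' : (s : ℂ) ^ 2 + (c : ℂ) ^ 2 = 1 := by exact_mod_cast hsc
  have key : (1 + (u : ℂ)⁻¹ * (c - s * Complex.I))⁻¹ - (1 + (u : ℂ)⁻¹ * (c + s * Complex.I))⁻¹ =
      2 * Complex.I * s * (u / (u ^ 2 + 2 * u * c + 1)) := by
    rw [inv_sub_inv h1 h2, ← mul_div_assoc, div_eq_div_iff (mul_ne_zero h1 h2) hd']
    field_simp
    linear_combination (-2 * Complex.I * s) * hsc' +
      (2 * Complex.I * s ^ 3) * Complex.I_sq
  rw [key]
  push_cast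
  ring

lemma tendsto_hankelArc_geomRemainder {α t : ℝ} (hα0 : 0 < α) (hα1 : α < 1) (ht : 0 < t)
    (n : ℕ) :
    Tendsto (hankelArc t (geomRemainder α n)) atTop
      (𝓝 ((2 * Real.sin (α * π) * ∫ s in Set.Ioi 0, mittagLefflerIntegrand α t s) -
        ∑ j ∈ Finset.range n,
          2 * π * ((-(t ^ α)) ^ j / Real.Gamma ((j : ℝ) * α + 1)) : ℝ)) := by
  induction n with
  | zero =>
    rw [Finset.sum_range_zero, sub_zero]
    have hexp : Tendsto (fun a => Real.exp (-α * a)) atBot atTop :=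
      Real.tendsto_exp_atTop.comp (tendsto_id.const_mul_atBot_of_neg (by linarith))
    refine tendsto_hankelArc_of_jump_eq (holomorphicOnStrip_geomRemainder hα0 hα1 0) ht
      (β := fun a => (Real.exp (-α * a) - 1)⁻¹)
      (tendsto_atTop_add_const_right _ (-1) hexp).inv_tendsto_atTop ?_
      (integrableOn_mittagLefflerIntegrand hα0 hα1 ht)
      (hankelJump_geomRemainder_zero hα0 hα1 t)
    filter_upwards [hexp.eventually_gt_atTop 1] with a ha y
    rw [geomRemainder, pow_zero, one_mul, norm_inv]
    refine inv_anti₀ (by linarith) ?_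
    have h := norm_sub_le_norm_add (Complex.exp (-(α * (a + y * Complex.I)))) 1
    have hn : ‖Complex.exp (-(α * (a + y * Complex.I)))‖ = Real.exp (-α * a) := by
      simp [Complex.norm_exp]
    rw [hn, norm_one, add_comm] at h
    exact h
  | succ n ih =>
    have h := ih.sub ((tendsto_hankelArc_exp (n * α) ht).const_mul ((-1) ^ n))
    simp only [← hankelArc_geomRemainder_succ hα0 hα1] at h
    convert h using 2
    have : t ^ (n * α) = (t ^ α) ^ n := by
      rw [← Real.rpow_natCast, ← Real.rpow_mul ht.le, mul_comm]
    rw [Finset.sum_range_succ, neg_pow, this]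
    push_cast
    ring

theorem mittagLeffler_integral_representation (α t : ℝ) (hα0 : 0 < α) (hα1 : α < 1)
    (ht : 0 < t) :
    IntegrableOn
      (fun s : ℝ =>
        s ^ (α - 1) * Real.exp (-(s * t)) / (s ^ (2 * α) + 2 * s ^ α * Real.cos (α * π) + 1))
      (Set.Ioi 0) ∧
    mittagLeffler α (-(t ^ α)) =
      (Real.sin (α * π) / π) *
        ∫ s in Set.Ioi (0 : ℝ),
          s ^ (α - 1) * Real.exp (-(s * t)) /
            (s ^ (2 * α) + 2 * s ^ α * Real.cos (α * π) + 1) := by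
  refine ⟨integrableOn_mittagLefflerIntegrand hα0 hα1 ht, ?_⟩
  change _ = _ * ∫ s in Set.Ioi (0 : ℝ), mittagLefflerIntegrand α t s
  set J := ∫ s in Set.Ioi (0 : ℝ), mittagLefflerIntegrand α t s
  have hpi := Real.pi_pos
  have hr0 := Real.exp_pos (-α)
  have hr1 : Real.exp (-α) < 1 := Real.exp_lt_one_iff.2 (by linarith)
  set C := 2 * π * Real.exp (t * Real.exp 1) + 2 / t
  set a : ℕ → ℝ := fun j => 2 * π * ((-(t ^ α)) ^ j / Real.Gamma ((j : ℝ) * α + 1)) with ha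
  have hterm : ∀ j : ℕ, ‖a j‖ ≤ C * Real.exp (-α) ^ j := by
    intro j
    have h := norm_le_of_tendsto_hankelArc (holomorphicOnStrip_exp (j * α)) ht
      (B := Real.exp (-α) ^ j) (fun w hw _ => ?_) (tendsto_hankelArc_exp (j * α) ht)
    · refine le_of_eq_of_le ?_ h
      have : t ^ (j * α) = (t ^ α) ^ j := by
        rw [← Real.rpow_natCast, ← Real.rpow_mul ht.le, mul_comm]
      rw [this, Complex.norm_real, ha]
      simp only [norm_mul, norm_div, norm_pow, norm_neg]
    · have e : Complex.exp (-((j * α : ℝ) * w)) = Complex.exp (-(α * w)) ^ j := by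
        rw [← Complex.exp_nat_mul]; push_cast; ring_nf
      rw [e, norm_pow]
      exact pow_le_pow_left₀ (norm_nonneg _) (norm_exp_le hα0 hw) _
  have hgeom := summable_geometric_of_lt_one hr0.le hr1
  have hsum : Summable a := Summable.of_norm_bounded (hgeom.mul_left C) hterm
  have hrem : ∀ n : ℕ, ‖(2 * Real.sin (α * π) * J) - ∑ j ∈ Finset.range n, a j‖ ≤
      C * (Real.exp (-α) ^ n * (1 - Real.exp (-α))⁻¹) := by
    intro n
    have h := norm_le_of_tendsto_hankelArc (holomorphicOnStrip_geomRemainder hα0 hα1 n) ht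
      (fun w hw _ => norm_geomRemainder_le hα0 n hw)
      (tendsto_hankelArc_geomRemainder hα0 hα1 ht n)
    rwa [Complex.norm_real] at h
  have hlim : Tendsto (fun n => C * (Real.exp (-α) ^ n * (1 - Real.exp (-α))⁻¹)) atTop (𝓝 0) := by
    simpa using ((tendsto_pow_atTop_nhds_zero_of_lt_one hr0.le hr1).mul_const
      (1 - Real.exp (-α))⁻¹).const_mul C
  have hpartial : Tendsto (fun n => ∑ j ∈ Finset.range n, a j) atTop
      (𝓝 (2 * Real.sin (α * π) * J)) := by
    have h := (squeeze_zero_norm hrem hlim).const_sub (2 * Real.sin (α * π) * J)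
    simpa using h
  have htsum := (hsum.hasSum_iff_tendsto_nat.2 hpartial).tsum_eq
  rw [ha, tsum_mul_left] at htsum
  change 2 * π * mittagLeffler α (-(t ^ α)) = _ at htsum
  field_simp
  linear_combination htsum / 2
end

section
/- Let 0 < α < 1 and τ_σ, τ_ε > 0. Suppose y, g : [0,∞) → ℝ are continuously differentiable and there exist constants M, c > 0 with |y(t)|, |y'(t)|, |g(t)|, |g'(t)| ≤ M e^{c t} for all t ≥ 0. Assume that for all t > 0 the fractional constitutive equation y(t) + τ_σ^α (D^α y)(t) = g(t) + τ_ε^α (D^α g)(t) holds. Then for all t ≥ 0, y(t) = ((τ_ε/τ_σ)^α − 1) ∫_0^t E_α(−((t−s)/τ_σ)^α) g'(s) ds + g(t) + E_α(−(t/τ_σ)^α) (y(0) − g(0)). -/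
open scoped Real
open MeasureTheory

/-- The Caputo fractional derivative of order `α`:
`(D^α h)(t) = (1/Γ(1−α)) ∫_0^t h'(s) (t−s)^{−α} ds`. -/
noncomputable def caputoDeriv (α : ℝ) (h : ℝ → ℝ) (t : ℝ) : ℝ :=
  (1 / Real.Gamma (1 - α)) * ∫ s in (0 : ℝ)..t, deriv h s * (t - s) ^ (-α)

/-- The Riemann–Liouville fractional integral of order `a` based at `0`. -/
noncomputable def rlIntegral (a : ℝ) (h : ℝ → ℝ) (t : ℝ) : ℝ :=
  (1 / Real.Gamma a) * ∫ s in (0 : ℝ)..t, h s * (t - s) ^ (a - 1)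

lemma integral_rpow_mul_sub_rpow {a b c : ℝ} (ha : 0 < a) (hb : 0 < b) (hc : 0 < c) :
    ∫ x in (0 : ℝ)..c, x ^ (a - 1) * (c - x) ^ (b - 1) =
      c ^ (a + b - 1) * (Real.Gamma a * Real.Gamma b / Real.Gamma (a + b)) := by
  have h := Complex.betaIntegral_scaled (a : ℂ) (b : ℂ) hc
  rw [Complex.betaIntegral_eq_Gamma_mul_div _ _ (by simpa) (by simpa)] at h
  apply Complex.ofReal_injective
  rw [← intervalIntegral.integral_ofReal]
  have h2 : ∫ x in (0 : ℝ)..c, ((x ^ (a - 1) * (c - x) ^ (b - 1) : ℝ) : ℂ) =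
      ∫ x in (0 : ℝ)..c, (x : ℂ) ^ ((a : ℂ) - 1) * ((c : ℂ) - x) ^ ((b : ℂ) - 1) := by
    refine intervalIntegral.integral_congr fun x hx => ?_
    rw [Set.uIcc_of_le hc.le] at hx
    rw [Complex.ofReal_mul, Complex.ofReal_cpow hx.1, Complex.ofReal_cpow (sub_nonneg.2 hx.2)]
    push_cast
    rfl
  rw [h2, h]
  simp only [← Complex.ofReal_add, Complex.Gamma_ofReal]
  rw [Complex.ofReal_mul, Complex.ofReal_cpow hc.le]
  push_cast
  rfl

lemma integral_sub_rpow_mul_sub_rpow {a b r t : ℝ} (ha : 0 < a) (hb : 0 < b) (hrt : r < t) :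
    ∫ s in r..t, (t - s) ^ (a - 1) * (s - r) ^ (b - 1) =
      (t - r) ^ (a + b - 1) * (Real.Gamma a * Real.Gamma b / Real.Gamma (a + b)) := by
  have h := intervalIntegral.integral_comp_sub_right (a := r) (b := t)
    (fun x => x ^ (b - 1) * ((t - r) - x) ^ (a - 1)) r
  rw [sub_self, integral_rpow_mul_sub_rpow hb ha (sub_pos.2 hrt)] at h
  simp only [sub_sub_sub_cancel_right] at h
  rw [add_comm a b, mul_comm (Real.Gamma a), ← h]
  exact intervalIntegral.integral_congr fun s _ => mul_comm _ _

lemma intervalIntegrable_sub_rpow {a : ℝ} (ha : 0 < a) (r t : ℝ) :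
    IntervalIntegrable (fun s => (t - s) ^ (a - 1)) volume r t := by
  have h := (intervalIntegral.intervalIntegrable_rpow' (a := t - r) (b := 0)
    (r := a - 1) (by linarith)).comp_sub_left t
  simpa using h

lemma integral_sub_rpow {a : ℝ} (ha : 0 < a) (t : ℝ) :
    ∫ s in (0 : ℝ)..t, (t - s) ^ (a - 1) = t ^ a / a := by
  rw [intervalIntegral.integral_comp_sub_left (fun x => x ^ (a - 1)) t, sub_self, sub_zero,
    integral_rpow (Or.inl (by linarith)), sub_add_cancel, Real.zero_rpow ha.ne', sub_zero]

lemma integrable_triangle_kernel {a b t : ℝ} (ha : 0 < a) (hb : 0 < b) (ht : 0 ≤ t) {h : ℝ → ℝ}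
    (hh : Continuous h) :
    Integrable (Function.uncurry fun s r : ℝ =>
        (t - s) ^ (a - 1) * (Set.Iio s).indicator (fun r => h r * (s - r) ^ (b - 1)) r)
      ((volume.restrict (Set.Ioc 0 t)).prod (volume.restrict (Set.Ioc 0 t))) := by
  obtain ⟨C, hC⟩ := isCompact_Icc.exists_bound_of_continuousOn (s := Set.Icc 0 t) hh.continuousOn
  have hC0 : 0 ≤ C := (norm_nonneg _).trans (hC 0 ⟨le_rfl, ht⟩)
  have hker : ∀ s ∈ Set.Ioc 0 t,
      IntegrableOn (fun r => (s - r) ^ (b - 1)) (Set.Ioc 0 t ∩ Set.Iio s) := by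
    intro s hs
    have h1 := intervalIntegrable_sub_rpow hb 0 s
    rw [intervalIntegrable_iff_integrableOn_Ioc_of_le hs.1.le] at h1
    exact h1.mono_set fun r hr => ⟨hr.1.1, hr.2.le⟩
  have hmeas : Measurable (Function.uncurry fun s r : ℝ =>
        (t - s) ^ (a - 1) * (Set.Iio s).indicator (fun r => h r * (s - r) ^ (b - 1)) r) := by
    have : (Function.uncurry fun s r : ℝ =>
        (t - s) ^ (a - 1) * (Set.Iio s).indicator (fun r => h r * (s - r) ^ (b - 1)) r) =
        fun p : ℝ × ℝ => (t - p.1) ^ (a - 1) *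
          {p : ℝ × ℝ | p.2 < p.1}.indicator (fun p => h p.2 * (p.1 - p.2) ^ (b - 1)) p := by
      ext ⟨s, r⟩
      simp [Set.indicator]
    rw [this]
    refine Measurable.mul (by fun_prop) (Measurable.indicator ?_ ?_)
    · have := hh.measurable
      fun_prop
    · exact measurableSet_lt measurable_snd measurable_fst
  rw [integrable_prod_iff hmeas.aestronglyMeasurable]
  constructor
  · refine (ae_restrict_mem measurableSet_Ioc).mono fun s hs => ?_
    simp only [Function.uncurry_apply_pair]
    refine Integrable.const_mul ?_ _
    rw [integrable_indicator_iff measurableSet_Iio, IntegrableOn,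
      Measure.restrict_restrict measurableSet_Iio, Set.inter_comm]
    refine (hker s hs).bdd_mul (c := C) hh.aestronglyMeasurable ?_
    exact (ae_restrict_mem (measurableSet_Ioc.inter measurableSet_Iio)).mono
      fun r hr => hC r ⟨hr.1.1.le, hr.1.2⟩
  · have hdom : Integrable (fun s => (C * (t ^ b / b)) * (t - s) ^ (a - 1))
        (volume.restrict (Set.Ioc 0 t)) := by
      have h1 := intervalIntegrable_sub_rpow ha 0 t
      rw [intervalIntegrable_iff_integrableOn_Ioc_of_le ht] at h1
      exact h1.const_mul _
    refine hdom.mono' hmeas.aestronglyMeasurable.norm.integral_prod_right' ?_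
    refine (ae_restrict_mem measurableSet_Ioc).mono fun s hs => ?_
    simp only [Function.uncurry_apply_pair, norm_mul, norm_indicator_eq_indicator_norm]
    rw [integral_const_mul, setIntegral_indicator measurableSet_Iio, norm_mul, norm_norm,
      Real.norm_of_nonneg (Real.rpow_nonneg (sub_nonneg.2 hs.2) _), mul_comm]
    refine mul_le_mul_of_nonneg_right ?_ (Real.rpow_nonneg (sub_nonneg.2 hs.2) _)
    rw [Real.norm_of_nonneg (integral_nonneg fun r => by positivity)]
    calc _ ≤ ∫ r in Set.Ioc 0 t ∩ Set.Iio s, C * (s - r) ^ (b - 1) := by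
          refine integral_mono_of_nonneg (.of_forall fun r => by positivity)
            ((hker s hs).const_mul _) ?_
          refine (ae_restrict_mem (measurableSet_Ioc.inter measurableSet_Iio)).mono fun r hr => ?_
          simp only
          rw [Real.norm_of_nonneg (Real.rpow_nonneg (sub_nonneg.2 (le_of_lt hr.2)) (b - 1))]
          exact mul_le_mul_of_nonneg_right (hC r ⟨hr.1.1.le, hr.1.2⟩)
            (Real.rpow_nonneg (sub_nonneg.2 (le_of_lt hr.2)) (b - 1))
      _ = C * (s ^ b / b) := by
          have hset : Set.Ioc 0 t ∩ Set.Iio s = Set.Ioo 0 s := by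
            ext r
            exact ⟨fun hr => ⟨hr.1.1, hr.2⟩, fun hr => ⟨⟨hr.1, hr.2.le.trans hs.2⟩, hr.2⟩⟩
          rw [integral_const_mul, hset, ← integral_Ioc_eq_integral_Ioo,
            ← intervalIntegral.integral_of_le hs.1.le, integral_sub_rpow hb]
      _ ≤ C * (t ^ b / b) := by
          have := Real.rpow_le_rpow hs.1.le hs.2 hb.le
          gcongr

/-- Riemann–Liouville integrals form a semigroup. -/
theorem rlIntegral_rlIntegral {a b t : ℝ} (ha : 0 < a) (hb : 0 < b) (ht : 0 ≤ t) {h : ℝ → ℝ}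
    (hh : Continuous h) :
    rlIntegral a (rlIntegral b h) t = rlIntegral (a + b) h t := by
  have hswap := integral_integral_swap (integrable_triangle_kernel ha hb ht hh)
  have hleft : ∀ s ∈ Set.Ioc 0 t, ∫ r in Set.Ioc 0 t, (t - s) ^ (a - 1) *
      (Set.Iio s).indicator (fun r => h r * (s - r) ^ (b - 1)) r =
      Real.Gamma b * (rlIntegral b h s * (t - s) ^ (a - 1)) := by
    intro s hs
    have hset : Set.Ioc 0 t ∩ Set.Iio s = Set.Ioo 0 s := by
      ext r
      exact ⟨fun hr => ⟨hr.1.1, hr.2⟩, fun hr => ⟨⟨hr.1, hr.2.le.trans hs.2⟩, hr.2⟩⟩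
    rw [integral_const_mul, setIntegral_indicator measurableSet_Iio, hset,
      ← integral_Ioc_eq_integral_Ioo, ← intervalIntegral.integral_of_le hs.1.le, rlIntegral]
    have := (Real.Gamma_pos_of_pos hb).ne'
    field_simp
  have hright : ∀ r ∈ Set.Ioo 0 t, ∫ s in Set.Ioc 0 t, (t - s) ^ (a - 1) *
      (Set.Iio s).indicator (fun r => h r * (s - r) ^ (b - 1)) r =
      (Real.Gamma a * Real.Gamma b / Real.Gamma (a + b)) * (h r * (t - r) ^ (a + b - 1)) := by
    intro r hr
    have hset : Set.Ioc 0 t ∩ Set.Ioi r = Set.Ioc r t := by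
      ext s
      exact ⟨fun hs => ⟨hs.2, hs.1.2⟩, fun hs => ⟨⟨hr.1.trans hs.1, hs.2⟩, hs.1⟩⟩
    have hfun : (fun s => (t - s) ^ (a - 1) *
        (Set.Iio s).indicator (fun r => h r * (s - r) ^ (b - 1)) r) =
        (Set.Ioi r).indicator fun s => h r * ((t - s) ^ (a - 1) * (s - r) ^ (b - 1)) := by
      ext s
      by_cases hrs : r < s
      · simp [hrs]; ring
      · simp [hrs]
    rw [hfun, setIntegral_indicator measurableSet_Ioi, hset, integral_const_mul,
      ← intervalIntegral.integral_of_le hr.2.le, integral_sub_rpow_mul_sub_rpow ha hb hr.2]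
    ring
  rw [setIntegral_congr_fun measurableSet_Ioc hleft, integral_Ioc_eq_integral_Ioo (y := t)
    (f := fun r => ∫ s in Set.Ioc 0 t, (t - s) ^ (a - 1) *
      (Set.Iio s).indicator (fun r => h r * (s - r) ^ (b - 1)) r),
    setIntegral_congr_fun measurableSet_Ioo hright, ← integral_Ioc_eq_integral_Ioo,
    integral_const_mul, integral_const_mul, ← intervalIntegral.integral_of_le ht,
    ← intervalIntegral.integral_of_le ht] at hswap
  have h1 := (Real.Gamma_pos_of_pos ha).ne'
  have h2 := (Real.Gamma_pos_of_pos hb).ne'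
  rw [rlIntegral, rlIntegral]
  apply mul_left_cancel₀ h2
  rw [mul_left_comm, hswap]
  field_simp

lemma rlIntegral_congr {a t : ℝ} (ht : 0 ≤ t) {h₁ h₂ : ℝ → ℝ}
    (h : ∀ s ∈ Set.Ioc 0 t, h₁ s = h₂ s) : rlIntegral a h₁ t = rlIntegral a h₂ t := by
  rw [rlIntegral, rlIntegral, intervalIntegral.integral_of_le ht,
    intervalIntegral.integral_of_le ht]
  congr 1
  exact setIntegral_congr_fun measurableSet_Ioc fun s hs => by simp only [h s hs]

lemma rlIntegral_sub {a : ℝ} (ha : 0 < a) (t : ℝ) {h₁ h₂ : ℝ → ℝ} (hh₁ : Continuous h₁)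
    (hh₂ : Continuous h₂) :
    rlIntegral a (fun s => h₁ s - h₂ s) t = rlIntegral a h₁ t - rlIntegral a h₂ t := by
  have h := intervalIntegrable_sub_rpow ha 0 t
  simp only [rlIntegral, sub_mul]
  rw [intervalIntegral.integral_sub (h.continuousOn_mul hh₁.continuousOn)
    (h.continuousOn_mul hh₂.continuousOn), mul_sub]

lemma rlIntegral_const_mul (a k t : ℝ) (h : ℝ → ℝ) :
    rlIntegral a (fun s => k * h s) t = k * rlIntegral a h t := by
  simp only [rlIntegral, mul_assoc]
  rw [intervalIntegral.integral_const_mul]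
  ring

lemma rlIntegral_const {a : ℝ} (ha : 0 < a) (k t : ℝ) :
    rlIntegral a (fun _ => k) t = k * (t ^ a / Real.Gamma (a + 1)) := by
  rw [rlIntegral, intervalIntegral.integral_const_mul, integral_sub_rpow ha,
    Real.Gamma_add_one ha.ne']
  have := (Real.Gamma_pos_of_pos ha).ne'
  field_simp

lemma rlIntegral_one (h : ℝ → ℝ) (t : ℝ) : rlIntegral 1 h t = ∫ s in (0 : ℝ)..t, h s := by
  simp [rlIntegral]

lemma rpow_mul_exp_neg_le_Gamma {s x : ℝ} (hs : 0 ≤ s) (hx : 0 ≤ x) :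
    x ^ s * Real.exp (-x) ≤ Real.Gamma (s + 1) := by
  have hint := Real.GammaIntegral_convergent (s := s + 1) (by linarith)
  rw [Real.Gamma_eq_integral (by linarith), ← integral_exp_neg_Ioi, ← integral_const_mul]
  refine (setIntegral_mono_on ((integrableOn_exp_neg_Ioi x).const_mul _)
    (hint.mono_set (Set.Ioi_subset_Ioi hx)) measurableSet_Ioi fun r hr => ?_).trans
    (setIntegral_mono_set hint ?_ (Set.Ioi_subset_Ioi hx).eventuallyLE)
  · rw [add_sub_cancel_right, mul_comm]
    have := Real.rpow_le_rpow hx (le_of_lt hr) hs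
    gcongr
  · refine (ae_restrict_mem measurableSet_Ioi).mono fun r (hr : 0 < r) => ?_
    simp only [Pi.zero_apply]
    positivity

lemma summable_mittagLeffler {α : ℝ} (hα : 0 < α) (x : ℝ) :
    Summable fun j : ℕ => x ^ j / Real.Gamma ((j : ℝ) * α + 1) := by
  set B : ℝ := 2 * (|x| + 1)
  have hB : 0 < B := by positivity
  set X : ℝ := B ^ (1 / α)
  refine Summable.of_norm_bounded (summable_geometric_two.mul_left (Real.exp X)) fun j => ?_
  have hG := rpow_mul_exp_neg_le_Gamma (s := j * α) (x := X) (by positivity) (by positivity)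
  have hX : X ^ ((j : ℝ) * α) = B ^ j := by
    rw [← Real.rpow_mul hB.le, ← Real.rpow_natCast]
    congr 1
    field_simp
  rw [hX] at hG
  have hxB : |x| ≤ B * (1 / 2) := by simp only [B]; linarith
  rw [norm_div, norm_pow, Real.norm_eq_abs, Real.norm_of_nonneg (le_trans (by positivity) hG)]
  calc |x| ^ j / Real.Gamma (j * α + 1) ≤ (B * (1 / 2)) ^ j / (B ^ j * Real.exp (-X)) := by
        gcongr
    _ = Real.exp X * (1 / 2) ^ j := by
        rw [mul_pow, Real.exp_neg]
        field_simp

lemma hasSum_mittagLeffler {α : ℝ} (hα : 0 < α) (x : ℝ) :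
    HasSum (fun j : ℕ => x ^ j / Real.Gamma ((j : ℝ) * α + 1)) (mittagLeffler α x) :=
  (summable_mittagLeffler hα x).hasSum

lemma neg_div_rpow_pow {α τ x : ℝ} (hτ : 0 < τ) (hx : 0 ≤ x) (n : ℕ) :
    (-((x / τ) ^ α)) ^ n = (-(1 / τ ^ α)) ^ n * x ^ ((n : ℝ) * α) := by
  rw [mul_comm (n : ℝ), Real.rpow_mul_natCast hx, ← mul_pow, Real.div_rpow hx hτ.le]
  congr 1
  ring

/-- Convolution with a Mittag-Leffler kernel is a Neumann series of fractional integrals. -/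
theorem hasSum_rlIntegral {α τ t : ℝ} (hα : 0 < α) (hτ : 0 < τ) (ht : 0 ≤ t) {v : ℝ → ℝ}
    (hv : Continuous v) :
    HasSum (fun n : ℕ => (-(1 / τ ^ α)) ^ n * rlIntegral ((n : ℝ) * α + 1) v t)
      (∫ s in (0 : ℝ)..t, mittagLeffler α (-(((t - s) / τ) ^ α)) * v s) := by
  obtain ⟨C, hC⟩ := isCompact_Icc.exists_bound_of_continuousOn (s := Set.Icc 0 t) hv.continuousOn
  have hC0 : 0 ≤ C := (norm_nonneg _).trans (hC 0 ⟨le_rfl, ht⟩)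
  have hterm : ∀ n : ℕ, (-(1 / τ ^ α)) ^ n * rlIntegral ((n : ℝ) * α + 1) v t =
      ∫ s in (0 : ℝ)..t, (-(((t - s) / τ) ^ α)) ^ n / Real.Gamma ((n : ℝ) * α + 1) * v s := by
    intro n
    rw [rlIntegral, ← mul_assoc, ← intervalIntegral.integral_const_mul]
    refine intervalIntegral.integral_congr fun s hs => ?_
    rw [Set.uIcc_of_le ht] at hs
    rw [neg_div_rpow_pow hτ (sub_nonneg.2 hs.2), add_sub_cancel_right]
    ring
  simp_rw [hterm]
  have hsum := (summable_mittagLeffler hα ((t / τ) ^ α)).mul_right C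
  refine intervalIntegral.hasSum_integral_of_dominated_convergence
    (fun n _ => ((t / τ) ^ α) ^ n / Real.Gamma ((n : ℝ) * α + 1) * C) (fun n => ?_) (fun n => ?_)
    (.of_forall fun _ _ => hsum) (by simp) (.of_forall fun s _ => ?_)
  · have := hv.measurable
    exact Measurable.aestronglyMeasurable (by fun_prop)
  · refine .of_forall fun s hs => ?_
    rw [Set.uIoc_of_le ht] at hs
    have hG : 0 < Real.Gamma ((n : ℝ) * α + 1) := Real.Gamma_pos_of_pos (by positivity)
    have hs' : 0 ≤ (t - s) / τ := div_nonneg (sub_nonneg.2 hs.2) hτ.le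
    have hst : (t - s) / τ ≤ t / τ := by
      have := hs.1
      gcongr
      linarith
    rw [norm_mul, norm_div, norm_pow, norm_neg, Real.norm_of_nonneg hG.le,
      Real.norm_of_nonneg (Real.rpow_nonneg hs' _)]
    have := hC s ⟨hs.1.le, hs.2⟩
    gcongr
  · exact (hasSum_mittagLeffler hα _).mul_right _

theorem fractional_constitutive_solution (α τσ τε : ℝ) (hα0 : 0 < α) (hα1 : α < 1)
    (hτσ : 0 < τσ) (hτε : 0 < τε) (y g : ℝ → ℝ) (hy : ContDiff ℝ 1 y) (hg : ContDiff ℝ 1 g)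
    (M c : ℝ) (hM : 0 < M) (hc : 0 < c)
    (hybound : ∀ t : ℝ, 0 ≤ t → |y t| ≤ M * Real.exp (c * t))
    (hy'bound : ∀ t : ℝ, 0 ≤ t → |deriv y t| ≤ M * Real.exp (c * t))
    (hgbound : ∀ t : ℝ, 0 ≤ t → |g t| ≤ M * Real.exp (c * t))
    (hg'bound : ∀ t : ℝ, 0 ≤ t → |deriv g t| ≤ M * Real.exp (c * t))
    (heq : ∀ t : ℝ, 0 < t →
      y t + τσ ^ α * caputoDeriv α y t = g t + τε ^ α * caputoDeriv α g t) :
    ∀ t : ℝ, 0 ≤ t →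
      y t = ((τε / τσ) ^ α - 1) *
          (∫ s in (0 : ℝ)..t, mittagLeffler α (-(((t - s) / τσ) ^ α)) * deriv g s) +
        g t + mittagLeffler α (-((t / τσ) ^ α)) * (y 0 - g 0) := by
  intro t ht
  have hy' : Continuous (deriv y) := hy.continuous_deriv le_rfl
  have hg' : Continuous (deriv g) := hg.continuous_deriv le_rfl
  set w : ℝ → ℝ := fun s => deriv y s - deriv g s
  have hw : Continuous w := hy'.sub hg'
  have hcaputo : ∀ (h : ℝ → ℝ) (s : ℝ), caputoDeriv α h s = rlIntegral (1 - α) (deriv h) s := by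
    intro h s
    rw [caputoDeriv, rlIntegral, show 1 - α - 1 = -α by ring]
  have hftc : ∀ s, rlIntegral 1 w s = (y s - g s) - (y 0 - g 0) := by
    intro s
    rw [rlIntegral_one, intervalIntegral.integral_sub (hy'.intervalIntegrable _ _)
      (hg'.intervalIntegrable _ _), intervalIntegral.integral_deriv_eq_sub
      (fun x _ => hy.differentiable one_ne_zero x) (hy'.intervalIntegrable _ _),
      intervalIntegral.integral_deriv_eq_sub
      (fun x _ => hg.differentiable one_ne_zero x) (hg'.intervalIntegrable _ _)]
    ring
  set q : ℝ → ℝ := fun s => (τε ^ α - τσ ^ α) * deriv g s - τσ ^ α * w s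
  have hq : Continuous q := (hg'.const_mul _).sub (hw.const_mul _)
  have hrlq : ∀ {a : ℝ}, 0 < a → ∀ s, rlIntegral a q s =
      (τε ^ α - τσ ^ α) * rlIntegral a (deriv g) s - τσ ^ α * rlIntegral a w s := by
    intro a ha s
    rw [rlIntegral_sub ha s (hg'.const_mul _) (hw.const_mul _), rlIntegral_const_mul,
      rlIntegral_const_mul]
  have hsol : ∀ s, 0 < s → y s - g s = rlIntegral (1 - α) q s := by
    intro s hs
    have h := heq s hs
    rw [hcaputo, hcaputo] at h
    rw [hrlq (by linarith), rlIntegral_sub (by linarith) s hy' hg']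
    linear_combination h
  have hτpos : 0 < τσ ^ α := Real.rpow_pos_of_pos hτσ α
  have hrec : ∀ n : ℕ, (-(1 / τσ ^ α)) ^ n * rlIntegral ((n : ℝ) * α + 1) w t =
      ((τε / τσ) ^ α - 1) * ((-(1 / τσ ^ α)) ^ n * rlIntegral ((n : ℝ) * α + 1) (deriv g) t) +
      (-((t / τσ) ^ α)) ^ (n + 1) / Real.Gamma (((n + 1 : ℕ) : ℝ) * α + 1) * (y 0 - g 0) +
      (-(1 / τσ ^ α)) ^ (n + 1) * rlIntegral (((n + 1 : ℕ) : ℝ) * α + 1) w t := by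
    intro n
    have hβ : 0 < ((n + 1 : ℕ) : ℝ) * α := by positivity
    have h1 : rlIntegral (((n + 1 : ℕ) : ℝ) * α) (fun s => y s - g s) t =
        rlIntegral ((n : ℝ) * α + 1) q t := by
      rw [rlIntegral_congr ht fun s hs => hsol s hs.1,
        rlIntegral_rlIntegral hβ (by linarith) ht hq]
      congr 1
      push_cast
      ring
    have h2 := rlIntegral_rlIntegral hβ one_pos ht hw
    rw [rlIntegral_congr ht fun s _ => hftc s,
      rlIntegral_sub hβ t (h₁ := fun s => y s - g s) (hy.continuous.sub hg.continuous)
        continuous_const,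
      rlIntegral_const hβ, h1, hrlq (by positivity)] at h2
    rw [← h2, neg_div_rpow_pow hτσ ht, Real.div_rpow hτε.le hτσ.le, pow_succ]
    field_simp
    ring
  have hw_sum := hasSum_rlIntegral hα0 hτσ ht hw
  have htail := (hasSum_nat_add_iff' 1).2 hw_sum
  have hE := (hasSum_nat_add_iff' 1).2 (hasSum_mittagLeffler hα0 (-((t / τσ) ^ α)))
  have hg_sum := hasSum_rlIntegral hα0 hτσ ht hg'
  have huniq := hw_sum.unique ((((hg_sum.mul_left ((τε / τσ) ^ α - 1)).add
    (hE.mul_right (y 0 - g 0))).add htail).congr_fun hrec)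
  simp only [Finset.range_one, Finset.sum_singleton, pow_zero, Nat.cast_zero, zero_mul, zero_add,
    Real.Gamma_one, one_mul, div_one, hftc] at huniq
  linear_combination huniq
end
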